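/- Let (σ_n)_{n≥1} be a strictly increasing sequence of positive integers with σ_{n+1} − σ_n ≥ n for all n ≥ 1 and such that (σ_{n+1} − σ_n)/n converges to a finite limit β ≥ 1 as n → ∞. Then the Hausdorff dimension of G((σ_n)) equals (β−1)/(2β). -/

import Mathlib

open Filter MeasureTheory Set
open scoped ENNReal NNReal Topology

/-- The Gauss map `T(x) = 1/x - ⌊1/x⌋`. -/
noncomputable def gaussMap (x : ℝ) : ℝ := 1 / x - ⌊1 / x⌋

/-- The `n`-th partial quotient `a_n(x) = ⌊1 / T^{n-1} x⌋` of the regular continued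
fraction expansion of `x` (meaningful for `n ≥ 1` and `x` irrational in `(0,1)`). -/
noncomputable def pq (x : ℝ) (n : ℕ) : ℕ := (⌊1 / (gaussMap^[n - 1] x)⌋).toNat

/-- The set `J` of irrationals in `(0,1)` with strictly increasing partial quotients. -/
def Jset : Set ℝ :=
  {x | x ∈ Set.Ioo (0 : ℝ) 1 ∧ Irrational x ∧ ∀ n : ℕ, 1 ≤ n → pq x n < pq x (n + 1)}

/-- The finite sequence `b start, b (start+1), …, b (start+len-1)` is an
arithmetic progression. -/
def IsAPAt (b : ℕ → ℕ) (start len : ℕ) : Prop :=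
  ∃ d : ℤ, ∀ i : ℕ, i + 2 ≤ len → (b (start + i + 1) : ℤ) - (b (start + i) : ℤ) = d

/-- The `F`-set: points of `J` such that for infinitely many `n ≥ 1` the partial
quotients `a_n(x), …, a_{n+ν_n-1}(x)` form an arithmetic progression. -/
def Fset (ν : ℕ → ℕ) : Set ℝ :=
  {x | x ∈ Jset ∧ ∀ N : ℕ, ∃ n : ℕ, N ≤ n ∧ 1 ≤ n ∧ IsAPAt (pq x) n (ν n)}

/-- The `G`-set: points of `J` such that for all sufficiently large `n` the partial
quotients `a_{σ_n}(x), …, a_{σ_n+n-1}(x)` form an arithmetic progression. -/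
def Gset (σ : ℕ → ℕ) : Set ℝ :=
  {x | x ∈ Jset ∧ ∃ N : ℕ, ∀ n : ℕ, N ≤ n → IsAPAt (pq x) (σ n) n}

lemma gaussMap_mem {x : ℝ} (hx : x ∈ Ioo (0 : ℝ) 1 ∧ Irrational x) :
    gaussMap x ∈ Ioo (0 : ℝ) 1 ∧ Irrational (gaussMap x) := by
  have h1 : Irrational (gaussMap x) := by
    unfold gaussMap
    rw [one_div]
    exact (hx.2.inv).sub_intCast _
  have h2 : gaussMap x = Int.fract (1 / x) := rfl
  refine ⟨⟨lt_of_le_of_ne (h2 ▸ Int.fract_nonneg _) fun h => ?_, h2 ▸ Int.fract_lt_one _⟩, h1⟩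
  rw [← h] at h1
  exact not_irrational_zero h1

lemma gaussMap_iterate_mem {x : ℝ} (hx : x ∈ Ioo (0 : ℝ) 1 ∧ Irrational x) (j : ℕ) :
    gaussMap^[j] x ∈ Ioo (0 : ℝ) 1 ∧ Irrational (gaussMap^[j] x) := by
  induction j with
  | zero => exact hx
  | succ j ih =>
    rw [Function.iterate_succ_apply']
    exact gaussMap_mem ih

lemma one_div_gaussMap_iterate {x : ℝ} (hx : x ∈ Ioo (0 : ℝ) 1 ∧ Irrational x) (j : ℕ) :
    1 / gaussMap^[j] x = pq x (j + 1) + gaussMap^[j + 1] x := by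
  obtain ⟨⟨h0, -⟩, -⟩ := gaussMap_iterate_mem hx j
  rw [Function.iterate_succ_apply']
  have h2 : (0 : ℤ) ≤ ⌊1 / gaussMap^[j] x⌋ := Int.floor_nonneg.2 (by positivity)
  have h3 : ((pq x (j + 1) : ℕ) : ℝ) = (⌊1 / gaussMap^[j] x⌋ : ℝ) := by
    have : ((pq x (j + 1) : ℕ) : ℤ) = ⌊1 / gaussMap^[j] x⌋ := Int.toNat_of_nonneg h2
    exact_mod_cast this
  rw [h3]
  unfold gaussMap
  ring

lemma gaussMap_iterate_eq {x : ℝ} (hx : x ∈ Ioo (0 : ℝ) 1 ∧ Irrational x) (j : ℕ) :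
    gaussMap^[j] x = 1 / (pq x (j + 1) + gaussMap^[j + 1] x) := by
  rw [← one_div_gaussMap_iterate hx j, one_div_one_div]

lemma pq_pos {x : ℝ} (hx : x ∈ Ioo (0 : ℝ) 1 ∧ Irrational x) (j : ℕ) : 1 ≤ pq x (j + 1) := by
  obtain ⟨⟨h0, h1⟩, -⟩ := gaussMap_iterate_mem hx j
  obtain ⟨⟨-, h3⟩, -⟩ := gaussMap_iterate_mem hx (j + 1)
  have h4 := one_div_gaussMap_iterate hx j
  have h5 : 1 < 1 / gaussMap^[j] x := by rw [lt_div_iff₀ h0]; linarith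
  by_contra! h
  have h6 : pq x (j + 1) = 0 := by omega
  rw [h6] at h4
  push_cast at h4
  linarith

lemma abs_one_div_add_sub {a b u v : ℝ} (hu : 0 < a + u) (hv : 0 < b + v) :
    |1 / (a + u) - 1 / (b + v)| = 1 / (a + u) * (1 / (b + v)) * |b - a + v - u| := by
  have : 1 / (a + u) - 1 / (b + v) = 1 / (a + u) * (1 / (b + v)) * (b - a + v - u) := by
    field_simp
    ring
  rw [this, abs_mul, abs_of_pos (by positivity)]

lemma abs_sub_le_prod_inv_sq {x y : ℝ} (hx : x ∈ Ioo (0 : ℝ) 1 ∧ Irrational x)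
    (hy : y ∈ Ioo (0 : ℝ) 1 ∧ Irrational y) (t : ℕ)
    (h : ∀ j < t, pq x (j + 1) = pq y (j + 1)) :
    |x - y| ≤ (∏ j ∈ Finset.range t, ((pq x (j + 1) : ℝ) ^ 2)⁻¹) *
      |gaussMap^[t] x - gaussMap^[t] y| := by
  induction t with
  | zero => simp
  | succ t ih =>
    refine (ih fun j hj => h j (by omega)).trans ?_
    rw [Finset.prod_range_succ, mul_assoc]
    refine mul_le_mul_of_nonneg_left ?_ (Finset.prod_nonneg fun _ _ => by positivity)
    have hp : (1 : ℝ) ≤ pq x (t + 1) := by exact_mod_cast pq_pos hx t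
    obtain ⟨⟨hu, -⟩, -⟩ := gaussMap_iterate_mem hx (t + 1)
    obtain ⟨⟨hv, -⟩, -⟩ := gaussMap_iterate_mem hy (t + 1)
    rw [gaussMap_iterate_eq hx t, gaussMap_iterate_eq hy t, ← h t (by omega),
      abs_one_div_add_sub (by linarith) (by linarith), sub_self, zero_add, abs_sub_comm]
    refine mul_le_mul_of_nonneg_right ?_ (abs_nonneg _)
    rw [sq, mul_inv, ← one_div]
    gcongr <;> linarith

lemma prod_inv_sq_le_abs_sub {x y : ℝ} (hx : x ∈ Ioo (0 : ℝ) 1 ∧ Irrational x)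
    (hy : y ∈ Ioo (0 : ℝ) 1 ∧ Irrational y) (t : ℕ)
    (h : ∀ j < t, pq x (j + 1) = pq y (j + 1)) :
    (∏ j ∈ Finset.range t, (((pq x (j + 1) : ℝ) + 1) ^ 2)⁻¹) *
      |gaussMap^[t] x - gaussMap^[t] y| ≤ |x - y| := by
  induction t with
  | zero => simp
  | succ t ih =>
    refine le_trans ?_ (ih fun j hj => h j (by omega))
    rw [Finset.prod_range_succ, mul_assoc]
    refine mul_le_mul_of_nonneg_left ?_ (Finset.prod_nonneg fun _ _ => by positivity)
    have hp : (1 : ℝ) ≤ pq x (t + 1) := by exact_mod_cast pq_pos hx t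
    obtain ⟨⟨hu, hu'⟩, -⟩ := gaussMap_iterate_mem hx (t + 1)
    obtain ⟨⟨hv, hv'⟩, -⟩ := gaussMap_iterate_mem hy (t + 1)
    rw [gaussMap_iterate_eq hx t, gaussMap_iterate_eq hy t, ← h t (by omega),
      abs_one_div_add_sub (by linarith) (by linarith), sub_self, zero_add, abs_sub_comm]
    refine mul_le_mul_of_nonneg_right ?_ (abs_nonneg _)
    rw [sq, mul_inv, ← one_div]
    gcongr

/-- Two points whose partial quotients first differ in position `t` are separated. -/
lemma prod_le_abs_sub_of_pq_lt {x y : ℝ} (hx : x ∈ Ioo (0 : ℝ) 1 ∧ Irrational x)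
    (hy : y ∈ Ioo (0 : ℝ) 1 ∧ Irrational y) (t : ℕ)
    (h : ∀ j < t, pq x (j + 1) = pq y (j + 1)) (hlt : pq x (t + 1) < pq y (t + 1)) :
    (∏ j ∈ Finset.range t, (((pq x (j + 1) : ℝ) + 1) ^ 2)⁻¹) *
      (1 / ((pq x (t + 1) : ℝ) + 1) * (1 / ((pq y (t + 1) : ℝ) + 1)) *
        (1 / ((pq y (t + 1 + 1) : ℝ) + 1))) ≤ |x - y| := by
  refine le_trans ?_ (prod_inv_sq_le_abs_sub hx hy t h)
  refine mul_le_mul_of_nonneg_left ?_ (Finset.prod_nonneg fun _ _ => by positivity)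
  have hp : (1 : ℝ) ≤ pq x (t + 1) := by exact_mod_cast pq_pos hx t
  have hlt' : (pq x (t + 1) : ℝ) + 1 ≤ pq y (t + 1) := by exact_mod_cast hlt
  obtain ⟨⟨hu, hu'⟩, -⟩ := gaussMap_iterate_mem hx (t + 1)
  obtain ⟨⟨hv, hv'⟩, -⟩ := gaussMap_iterate_mem hy (t + 1)
  obtain ⟨⟨hw, hw'⟩, -⟩ := gaussMap_iterate_mem hy (t + 1 + 1)
  have hv2 := gaussMap_iterate_eq hy (t + 1)
  rw [gaussMap_iterate_eq hx t, gaussMap_iterate_eq hy t,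
    abs_one_div_add_sub (by linarith) (by linarith)]
  have h1 : 1 / ((pq y (t + 1 + 1) : ℝ) + 1) ≤
      |(pq y (t + 1) : ℝ) - pq x (t + 1) + gaussMap^[t + 1] y - gaussMap^[t + 1] x| := by
    refine le_trans ?_ (le_abs_self _)
    have : 1 / ((pq y (t + 1 + 1) : ℝ) + 1) ≤ gaussMap^[t + 1] y := by
      rw [hv2]; gcongr
    linarith
  gcongr

lemma abs_one_div_add_sub_le {a u v : ℝ} (ha : 2 ≤ a) (hu : 0 ≤ u) (hv : 0 ≤ v) :
    |1 / (a + u) - 1 / (a + v)| ≤ 1 / 4 * |u - v| := by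
  rw [abs_one_div_add_sub (by linarith) (by linarith), sub_self, zero_add, abs_sub_comm]
  refine mul_le_mul_of_nonneg_right ?_ (abs_nonneg _)
  calc 1 / (a + u) * (1 / (a + v)) ≤ 1 / 2 * (1 / 2) := by gcongr <;> linarith
    _ = 1 / 4 := by norm_num

/-- The finite continued fraction `[a k, …, a (k + n - 1)]`. -/
noncomputable def finCF (a : ℕ → ℕ) : ℕ → ℕ → ℝ
  | 0, _ => 0
  | n + 1, k => 1 / (a k + finCF a n (k + 1))

lemma finCF_nonneg (a : ℕ → ℕ) (n k : ℕ) : 0 ≤ finCF a n k := by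
  induction n generalizing k with
  | zero => simp [finCF]
  | succ n ih => have := ih (k + 1); simp only [finCF]; positivity

lemma dist_finCF_le {a : ℕ → ℕ} (ha : ∀ k, 2 ≤ a k) (n k : ℕ) :
    dist (finCF a n k) (finCF a (n + 1) k) ≤ 1 * (1 / 4) ^ n := by
  have ha' : ∀ k, (2 : ℝ) ≤ a k := fun k => by exact_mod_cast ha k
  rw [Real.dist_eq]
  induction n generalizing k with
  | zero =>
    simp only [finCF, zero_sub, abs_neg, add_zero, pow_zero, mul_one]
    rw [abs_of_nonneg (by positivity), div_le_one (by linarith [ha' k])]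
    linarith [ha' k]
  | succ n ih =>
    have := abs_one_div_add_sub_le (ha' k) (finCF_nonneg a n (k + 1)) (finCF_nonneg a (n + 1) (k + 1))
    have h2 := ih (k + 1)
    rw [finCF, finCF, pow_succ]
    linarith

lemma exists_complete_quotients {a : ℕ → ℕ} (ha : ∀ k, 2 ≤ a k) :
    ∃ X : ℕ → ℝ, ∀ k, 0 < X k ∧ X k < 1 ∧ X k = 1 / (a k + X (k + 1)) := by
  have hc : ∀ k, ∃ l, Tendsto (fun n => finCF a n k) atTop (𝓝 l) := fun k =>
    cauchySeq_tendsto_of_complete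
      (cauchySeq_of_le_geometric (1 / 4) 1 (by norm_num) fun n => dist_finCF_le ha n k)
  choose X hX using hc
  have ha' : ∀ k, (2 : ℝ) ≤ a k := fun k => by exact_mod_cast ha k
  have h0 : ∀ k, 0 ≤ X k := fun k => ge_of_tendsto' (hX k) fun n => finCF_nonneg a n k
  have hrec : ∀ k, X k = 1 / (a k + X (k + 1)) := fun k => by
    have h1 : Tendsto (fun n => finCF a (n + 1) k) atTop (𝓝 (X k)) :=
      (hX k).comp (tendsto_add_atTop_nat 1)
    have h2 : Tendsto (fun n => finCF a (n + 1) k) atTop (𝓝 (1 / (a k + X (k + 1)))) := by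
      refine Tendsto.div tendsto_const_nhds (tendsto_const_nhds.add (hX (k + 1))) ?_
      linarith [ha' k, h0 (k + 1)]
    exact tendsto_nhds_unique h1 h2
  refine ⟨X, fun k => ⟨?_, ?_, hrec k⟩⟩
  · rw [hrec]
    have := ha' k; have := h0 (k + 1)
    positivity
  · have := ha' k; have := h0 (k + 1)
    rw [hrec, div_lt_one (by linarith)]
    linarith

lemma irrational_of_complete_quotients {a : ℕ → ℕ} {X : ℕ → ℝ}
    (hX : ∀ k, 0 < X k ∧ X k < 1 ∧ X k = 1 / (a k + X (k + 1))) (k : ℕ) :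
    Irrational (X k) := by
  have key : ∀ q : ℕ, ∀ k : ℕ, ∀ p : ℤ, 0 < q → X k ≠ p / q := by
    intro q
    induction q using Nat.strong_induction_on with
    | _ q ih =>
      intro k p hq h
      obtain ⟨h0, h1, h2⟩ := hX k
      have hq' : (0 : ℝ) < q := by exact_mod_cast hq
      have hp : (p : ℝ) = X k * q := by rw [h]; field_simp
      have hp0 : 0 < p := by
        have : (0 : ℝ) < p := by rw [hp]; positivity
        exact_mod_cast this
      have hpq : p < q := by
        have : (p : ℝ) < q := by rw [hp]; nlinarith
        exact_mod_cast this
      lift p to ℕ using hp0.le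
      refine ih p (by omega) (k + 1) (q - a k * p) (by omega) ?_
      have hp' : (0 : ℝ) < p := by exact_mod_cast hp0
      have hne : (a k : ℝ) + X (k + 1) ≠ 0 := by
        intro h3; rw [h3] at h2; simp at h2; linarith
      rw [h] at h2
      push_cast at h2 ⊢
      field_simp at h2 ⊢
      linarith
  rintro ⟨r, hr⟩
  refine key r.den k r.num r.pos ?_
  rw [← hr]
  exact Rat.cast_def r

/-- Every sequence of integers `≥ 2` is the sequence of partial quotients of an irrational. -/
lemma exists_pq_eq {a : ℕ → ℕ} (ha : ∀ k, 2 ≤ a k) :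
    ∃ x : ℝ, (x ∈ Ioo (0 : ℝ) 1 ∧ Irrational x) ∧ ∀ j, pq x (j + 1) = a j := by
  obtain ⟨X, hX⟩ := exists_complete_quotients ha
  have hfl : ∀ j, ⌊1 / X j⌋ = a j := fun j => by
    rw [(hX j).2.2, one_div_one_div, Int.floor_eq_iff]
    obtain ⟨h0, h1, -⟩ := hX (j + 1)
    push_cast
    constructor <;> linarith
  have hit : ∀ j, gaussMap^[j] (X 0) = X j := fun j => by
    induction j with
    | zero => rfl
    | succ j ih =>
      rw [Function.iterate_succ_apply', ih, gaussMap, hfl, (hX j).2.2, one_div_one_div]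
      push_cast
      ring
  refine ⟨X 0, ⟨⟨(hX 0).1, (hX 0).2.1⟩, irrational_of_complete_quotients hX 0⟩, fun j => ?_⟩
  simp only [pq, Nat.add_sub_cancel]
  rw [hit, hfl, Int.toNat_natCast]

lemma tsum_prod_fin (w : ℕ → ℕ → ℝ≥0∞) (t : ℕ) :
    ∑' c : Fin t → ℕ, ∏ j : Fin t, w j (c j) = ∏ j ∈ Finset.range t, ∑' k, w j k := by
  induction t with
  | zero => simp
  | succ t ih =>
    rw [← (Fin.snocEquiv (fun _ : Fin (t + 1) => ℕ)).tsum_eq, ENNReal.tsum_prod',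
      Finset.prod_range_succ, ← ih, mul_comm, ← ENNReal.tsum_mul_right]
    refine tsum_congr fun k => ?_
    rw [← ENNReal.tsum_mul_left]
    refine tsum_congr fun c => ?_
    simp [Fin.prod_univ_castSucc, Fin.snocEquiv, mul_comm]

lemma pq_strictMono {x : ℝ} (hx : x ∈ Jset) : StrictMono fun j => pq x (j + 1) :=
  strictMono_nat_of_lt_succ fun j => hx.2.2 (j + 1) (by omega)

lemma succ_le_pq {x : ℝ} (hx : x ∈ Jset) (j : ℕ) : j + 1 ≤ pq x (j + 1) := by
  induction j with
  | zero => exact pq_pos ⟨hx.1, hx.2.1⟩ 0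
  | succ j ih => exact ih.trans_lt (hx.2.2 (j + 1) (by omega))

lemma le_of_gap {τ : ℕ → ℕ} (hgap : ∀ n, 1 ≤ n → τ n + n ≤ τ (n + 1)) {m n : ℕ} (hm : 1 ≤ m)
    (hmn : m ≤ n) : τ m ≤ τ n := by
  induction n, hmn using Nat.le_induction with
  | base => exact le_rfl
  | succ n hn ih => have := hgap n (by omega); omega

/-- Position `j` lies in one of the blocks after the `n₀`-th, beyond its first two places. -/
def Forced (τ : ℕ → ℕ) (n₀ j : ℕ) : Prop := ∃ n, n₀ < n ∧ τ n + 2 ≤ j ∧ j < τ n + n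

lemma not_forced {τ : ℕ → ℕ} (hgap : ∀ n, 1 ≤ n → τ n + n ≤ τ (n + 1)) {n₀ k j : ℕ}
    (h1 : τ k + k ≤ j) (h2 : j < τ (k + 1) + 2) :
    ¬ Forced τ n₀ j := by
  rintro ⟨n, hn, h3, h4⟩
  rcases le_or_gt n k with h | h
  · have := le_of_gap hgap (by omega) h; omega
  · have := le_of_gap hgap (by omega : 1 ≤ k + 1) h; omega

lemma not_forced_of_lt {τ : ℕ → ℕ} (hgap : ∀ n, 1 ≤ n → τ n + n ≤ τ (n + 1)) {n₀ j : ℕ}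
    (hn₀ : 1 ≤ n₀) (h1 : j < τ n₀ + n₀) : ¬ Forced τ n₀ j := by
  rintro ⟨n, hn, h3, h4⟩
  have := le_of_gap hgap (by omega : 1 ≤ n₀ + 1) hn
  have := hgap n₀ hn₀
  omega

open Classical in
/-- Upper weights attached to the positions of a sequence `a`. -/
noncomputable def seqWeight (τ : ℕ → ℕ) (n₀ : ℕ) (e : ℝ) (a : ℕ → ℕ) (j : ℕ) : ℝ :=
  if j < τ n₀ + n₀ then 1 else if Forced τ n₀ j then 1 else (a j : ℝ) ^ (-e)

lemma seqWeight_nonneg (τ : ℕ → ℕ) (n₀ : ℕ) (e : ℝ) (a : ℕ → ℕ) (j : ℕ) :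
    0 ≤ seqWeight τ n₀ e a j := by
  unfold seqWeight
  split_ifs <;> positivity

lemma prod_group_le {τ : ℕ → ℕ} (hgap : ∀ n, 1 ≤ n → τ n + n ≤ τ (n + 1)) {n₀ k : ℕ}
    (hn₀ : 1 ≤ n₀) (hk : n₀ ≤ k) {s e : ℝ} (hs : 0 < s) (he : 2 * s ≤ e)
    (hexp : (e - 2 * s) * ((τ (k + 1) + 2 - (τ k + k) : ℕ) : ℝ) ≤ 2 * s * ((k - 1 : ℕ) : ℝ))
    {a : ℕ → ℕ} (ha : StrictMono a) (ha1 : ∀ j, 1 ≤ a j) :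
    ∏ j ∈ Finset.Ico (τ k + k) (τ (k + 1) + (k + 1)), (a j : ℝ) ^ (-(2 * s)) ≤
      ∏ j ∈ Finset.Ico (τ k + k) (τ (k + 1) + (k + 1)), seqWeight τ n₀ e a j := by
  have hg := hgap k (by omega)
  have hn₀k : τ n₀ + n₀ ≤ τ k + k := by have := le_of_gap hgap hn₀ hk; omega
  have ha1' : ∀ j, (1 : ℝ) ≤ a j := fun j => by exact_mod_cast ha1 j
  obtain ⟨A, hA⟩ : ∃ A : ℝ, A = a (τ (k + 1) + 1) := ⟨_, rfl⟩
  have hA1 : 1 ≤ A := hA ▸ ha1' _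
  have h1 : τ k + k ≤ τ (k + 1) + 2 := by omega
  have h2 : τ (k + 1) + 2 ≤ τ (k + 1) + (k + 1) := by omega
  rw [← Finset.prod_Ico_consecutive (fun j => (a j : ℝ) ^ (-(2 * s))) h1 h2,
    ← Finset.prod_Ico_consecutive (seqWeight τ n₀ e a) h1 h2]
  have hF : ∏ j ∈ Finset.Ico (τ k + k) (τ (k + 1) + 2), (a j : ℝ) ^ (-(2 * s)) ≤
      (∏ j ∈ Finset.Ico (τ k + k) (τ (k + 1) + 2), seqWeight τ n₀ e a j) *
        (A ^ (e - 2 * s)) ^ (τ (k + 1) + 2 - (τ k + k)) := by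
    rw [← Nat.card_Ico, ← Finset.prod_const, ← Finset.prod_mul_distrib]
    refine Finset.prod_le_prod (fun j _ => by positivity) fun j hj => ?_
    rw [Finset.mem_Ico] at hj
    rw [seqWeight, if_neg (by omega), if_neg (not_forced hgap hj.1 hj.2)]
    have h1 : (a j : ℝ) ≤ A := by
      rw [hA]; exact_mod_cast ha.monotone (by omega : j ≤ τ (k + 1) + 1)
    have h0 : (0 : ℝ) < a j := by linarith [ha1' j]
    calc (a j : ℝ) ^ (-(2 * s)) = (a j : ℝ) ^ (-e) * (a j : ℝ) ^ (e - 2 * s) := by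
          rw [← Real.rpow_add h0]; congr 1; ring
      _ ≤ _ := by gcongr
  have hB : ∏ j ∈ Finset.Ico (τ (k + 1) + 2) (τ (k + 1) + (k + 1)), (a j : ℝ) ^ (-(2 * s)) ≤
      (A ^ (-(2 * s))) ^ (k - 1) := by
    have hc : k - 1 = (Finset.Ico (τ (k + 1) + 2) (τ (k + 1) + (k + 1))).card := by
      rw [Nat.card_Ico]; omega
    rw [hc, ← Finset.prod_const]
    refine Finset.prod_le_prod (fun j _ => by positivity) fun j hj => ?_
    rw [Finset.mem_Ico] at hj
    have h1 : A ≤ (a j : ℝ) := by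
      rw [hA]; exact_mod_cast ha.monotone (by omega : τ (k + 1) + 1 ≤ j)
    exact Real.rpow_le_rpow_of_nonpos (by linarith) h1 (by linarith)
  have hB1 : ∏ j ∈ Finset.Ico (τ (k + 1) + 2) (τ (k + 1) + (k + 1)), seqWeight τ n₀ e a j = 1 := by
    refine Finset.prod_eq_one fun j hj => ?_
    rw [Finset.mem_Ico] at hj
    rw [seqWeight, if_neg (by omega), if_pos ⟨k + 1, by omega, by omega, by omega⟩]
  have hAe : (A ^ (e - 2 * s)) ^ (τ (k + 1) + 2 - (τ k + k)) * (A ^ (-(2 * s))) ^ (k - 1) ≤ 1 := by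
    rw [← Real.rpow_mul_natCast (by linarith), ← Real.rpow_mul_natCast (by linarith),
      ← Real.rpow_add (by linarith)]
    exact Real.rpow_le_one_of_one_le_of_nonpos hA1 (by linarith)
  have hw : 0 ≤ ∏ j ∈ Finset.Ico (τ k + k) (τ (k + 1) + 2), seqWeight τ n₀ e a j :=
    Finset.prod_nonneg fun j _ => seqWeight_nonneg _ _ _ _ _
  rw [hB1, mul_one]
  refine (mul_le_mul hF hB (Finset.prod_nonneg fun j _ => by positivity) (by positivity)).trans ?_
  rw [mul_assoc]
  exact mul_le_of_le_one_right hw hAe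

lemma prod_rpow_le_prod_seqWeight {τ : ℕ → ℕ} (hgap : ∀ n, 1 ≤ n → τ n + n ≤ τ (n + 1)) {n₀ : ℕ}
    (hn₀ : 1 ≤ n₀) {s e : ℝ} (hs : 0 < s) (he : 2 * s ≤ e)
    (hexp : ∀ k, n₀ ≤ k →
      (e - 2 * s) * ((τ (k + 1) + 2 - (τ k + k) : ℕ) : ℝ) ≤ 2 * s * ((k - 1 : ℕ) : ℝ))
    {a : ℕ → ℕ} (ha : StrictMono a) (ha1 : ∀ j, 1 ≤ a j) {n : ℕ} (hn : n₀ ≤ n) :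
    ∏ j ∈ Finset.range (τ n + n), (a j : ℝ) ^ (-(2 * s)) ≤
      ∏ j ∈ Finset.range (τ n + n), seqWeight τ n₀ e a j := by
  induction n, hn using Nat.le_induction with
  | base =>
    refine Finset.prod_le_prod (fun j _ => by positivity) fun j hj => ?_
    rw [seqWeight, if_pos (Finset.mem_range.1 hj)]
    exact Real.rpow_le_one_of_one_le_of_nonpos (by exact_mod_cast ha1 j) (by linarith)
  | succ k hk ih =>
    have hg := hgap k (by omega)
    rw [← Finset.prod_range_mul_prod_Ico _ (by omega : τ k + k ≤ τ (k + 1) + (k + 1)),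
      ← Finset.prod_range_mul_prod_Ico _ (by omega : τ k + k ≤ τ (k + 1) + (k + 1))]
    exact mul_le_mul ih (prod_group_le hgap hn₀ hk hs he (hexp k hk) ha ha1)
      (Finset.prod_nonneg fun j _ => by positivity)
      (Finset.prod_nonneg fun j _ => seqWeight_nonneg _ _ _ _ _)

open Classical in
/-- The free coordinates of a sequence; forced positions are recorded as `0`. -/
noncomputable def freeCode (τ : ℕ → ℕ) (n₀ : ℕ) (a : ℕ → ℕ) (j : ℕ) : ℕ :=
  if Forced τ n₀ j then 0 else a j

lemma eq_of_freeCode_eq {τ : ℕ → ℕ} {n₀ : ℕ} {a b : ℕ → ℕ}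
    (ha : ∀ n, n₀ < n → ∀ i, i + 3 ≤ n → a (τ n + i + 2) + a (τ n + i) = 2 * a (τ n + i + 1))
    (hb : ∀ n, n₀ < n → ∀ i, i + 3 ≤ n → b (τ n + i + 2) + b (τ n + i) = 2 * b (τ n + i + 1))
    {t : ℕ} (h : ∀ j < t, freeCode τ n₀ a j = freeCode τ n₀ b j) :
    ∀ j < t, a j = b j := by
  intro j
  induction j using Nat.strong_induction_on with
  | _ j ih =>
    intro hj
    have h1 := h j hj
    unfold freeCode at h1
    split_ifs at h1 with hf
    · obtain ⟨n, hn, h2, h3⟩ := hf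
      have ha' := ha n hn (j - 2 - τ n) (by omega)
      have hb' := hb n hn (j - 2 - τ n) (by omega)
      rw [show τ n + (j - 2 - τ n) = j - 2 by omega, show j - 2 + 2 = j by omega,
        show j - 2 + 1 = j - 1 by omega] at ha' hb'
      have := ih (j - 2) (by omega) (by omega)
      have := ih (j - 1) (by omega) (by omega)
      omega
    · exact h1

open Classical in
/-- Weights on the free coordinates. -/
noncomputable def codeWeight (τ : ℕ → ℕ) (n₀ M K : ℕ) (e : ℝ) (j c : ℕ) : ℝ≥0∞ :=
  if j < τ n₀ + n₀ then (if c ≤ M then 1 else 0)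
  else if Forced τ n₀ j then (if c = 0 then 1 else 0)
  else (if K ≤ c then ENNReal.ofReal ((c : ℝ) ^ (-e)) else 0)

lemma codeWeight_freeCode {τ : ℕ → ℕ} (hgap : ∀ n, 1 ≤ n → τ n + n ≤ τ (n + 1)) {n₀ M K : ℕ}
    (hn₀ : 1 ≤ n₀) {e : ℝ} {a : ℕ → ℕ} (hM : ∀ j < τ n₀ + n₀, a j ≤ M)
    (hK : ∀ j, τ n₀ + n₀ ≤ j → K ≤ a j) (j : ℕ) :
    codeWeight τ n₀ M K e j (freeCode τ n₀ a j) = ENNReal.ofReal (seqWeight τ n₀ e a j) := by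
  unfold codeWeight freeCode seqWeight
  by_cases h1 : j < τ n₀ + n₀
  · simp [h1, not_forced_of_lt hgap hn₀ h1, hM j h1]
  · by_cases h2 : Forced τ n₀ j
    · simp [h1, h2]
    · simp [h1, h2, hK j (by omega)]

lemma tsum_codeWeight_le (τ : ℕ → ℕ) (n₀ M K : ℕ) (e : ℝ)
    (hK : ∑' c : ℕ, (if K ≤ c then ENNReal.ofReal ((c : ℝ) ^ (-e)) else 0) ≤ 1) (j : ℕ) :
    ∑' c, codeWeight τ n₀ M K e j c ≤ if j < τ n₀ + n₀ then (M + 1 : ℝ≥0∞) else 1 := by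
  unfold codeWeight
  by_cases h1 : j < τ n₀ + n₀
  · simp only [h1, if_true]
    rw [tsum_eq_sum (s := Finset.range (M + 1))
      (fun c hc => if_neg (by rw [Finset.mem_range] at hc; omega))]
    refine (Finset.sum_le_card_nsmul _ _ 1 fun c _ => by split_ifs <;> simp).trans ?_
    simp
  · by_cases h2 : Forced τ n₀ j
    · simp [h1, h2]
    · simpa [h1, h2] using hK

lemma prod_tsum_codeWeight_le (τ : ℕ → ℕ) (n₀ M K : ℕ) (e : ℝ)
    (hK : ∑' c : ℕ, (if K ≤ c then ENNReal.ofReal ((c : ℝ) ^ (-e)) else 0) ≤ 1) (t : ℕ) :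
    ∏ j ∈ Finset.range t, ∑' c, codeWeight τ n₀ M K e j c ≤ (M + 1 : ℝ≥0∞) ^ (τ n₀ + n₀) := by
  refine (Finset.prod_le_prod' fun j _ => tsum_codeWeight_le τ n₀ M K e hK j).trans ?_
  rw [Finset.prod_ite, Finset.prod_const, Finset.prod_const_one, mul_one]
  refine pow_le_pow_right₀ (by simp) ?_
  rw [← Finset.card_range (τ n₀ + n₀)]
  exact Finset.card_le_card fun j hj => by simpa using (Finset.mem_filter.1 hj).2

/-- Points of `J` whose blocks after the `n₀`-th are progressions and whose initial partial
quotients are at most `M`. -/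
def blockSet (τ : ℕ → ℕ) (n₀ M : ℕ) : Set ℝ :=
  {x | x ∈ Jset ∧ (∀ n, n₀ < n → ∀ i, i + 3 ≤ n →
    pq x (τ n + i + 2 + 1) + pq x (τ n + i + 1) = 2 * pq x (τ n + i + 1 + 1)) ∧
    ∀ j < τ n₀ + n₀, pq x (j + 1) ≤ M}

/-- The cylinder of points of `blockSet` with prescribed free coordinates. -/
def blockCyl (τ : ℕ → ℕ) (n₀ M t : ℕ) (c : Fin t → ℕ) : Set ℝ :=
  {x | x ∈ blockSet τ n₀ M ∧ ∀ j : Fin t, freeCode τ n₀ (fun j => pq x (j + 1)) j = c j}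

lemma ediam_blockCyl_le {τ : ℕ → ℕ} {n₀ M t : ℕ} {c : Fin t → ℕ} {x : ℝ}
    (hx : x ∈ blockCyl τ n₀ M t c) :
    Metric.ediam (blockCyl τ n₀ M t c) ≤
      ENNReal.ofReal (∏ j ∈ Finset.range t, ((pq x (j + 1) : ℝ) ^ 2)⁻¹) := by
  have key : ∀ y ∈ blockCyl τ n₀ M t c, ∀ j < t, pq x (j + 1) = pq y (j + 1) := fun y hy =>
    eq_of_freeCode_eq (a := fun j => pq x (j + 1)) (b := fun j => pq y (j + 1))
      hx.1.2.1 hy.1.2.1 fun j hj => (hx.2 ⟨j, hj⟩).trans (hy.2 ⟨j, hj⟩).symm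
  refine Metric.ediam_le fun y hy z hz => ?_
  rw [edist_dist, Real.dist_eq]
  refine ENNReal.ofReal_le_ofReal ?_
  have hy' : y ∈ Ioo (0 : ℝ) 1 ∧ Irrational y := ⟨hy.1.1.1, hy.1.1.2.1⟩
  have hz' : z ∈ Ioo (0 : ℝ) 1 ∧ Irrational z := ⟨hz.1.1.1, hz.1.1.2.1⟩
  have h1 := abs_sub_le_prod_inv_sq hy' hz' t
    fun j hj => (key y hy j hj).symm.trans (key z hz j hj)
  rw [Finset.prod_congr rfl fun j hj => by rw [← key y hy j (Finset.mem_range.1 hj)]] at h1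
  refine h1.trans (mul_le_of_le_one_right (Finset.prod_nonneg fun _ _ => by positivity) ?_)
  obtain ⟨⟨h2, h3⟩, -⟩ := gaussMap_iterate_mem hy' t
  obtain ⟨⟨h4, h5⟩, -⟩ := gaussMap_iterate_mem hz' t
  rw [abs_le]
  constructor <;> linarith

lemma prod_inv_sq_le_inv {x : ℝ} (hx : x ∈ Jset) {t : ℕ} (ht : 1 ≤ t) :
    ∏ j ∈ Finset.range t, ((pq x (j + 1) : ℝ) ^ 2)⁻¹ ≤ (t : ℝ)⁻¹ := by
  obtain ⟨t, rfl⟩ : ∃ u, t = u + 1 := ⟨t - 1, by omega⟩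
  have h1 : ∀ j, (1 : ℝ) ≤ pq x (j + 1) := fun j => by
    exact_mod_cast (pq_pos ⟨hx.1, hx.2.1⟩ j)
  rw [Finset.prod_range_succ]
  refine (mul_le_of_le_one_left (by positivity)
    (Finset.prod_le_one (fun _ _ => by positivity) fun j _ => ?_)).trans ?_
  · exact inv_le_one_of_one_le₀ (one_le_pow₀ (h1 j))
  · have h2 : ((t + 1 : ℕ) : ℝ) ≤ pq x (t + 1) := by exact_mod_cast succ_le_pq hx t
    have := h1 t
    refine inv_anti₀ (by positivity) (h2.trans ?_)
    nlinarith

lemma hausdorffMeasure_blockSet_le {τ : ℕ → ℕ} (hgap : ∀ n, 1 ≤ n → τ n + n ≤ τ (n + 1))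
    {n₀ : ℕ} (hn₀ : 1 ≤ n₀) {s e : ℝ} (hs : 0 < s) (he : 2 * s ≤ e)
    (hexp : ∀ k, n₀ ≤ k →
      (e - 2 * s) * ((τ (k + 1) + 2 - (τ k + k) : ℕ) : ℝ) ≤ 2 * s * ((k - 1 : ℕ) : ℝ))
    (hK : ∑' c : ℕ, (if n₀ ≤ c then ENNReal.ofReal ((c : ℝ) ^ (-e)) else 0) ≤ 1) (M : ℕ) :
    μH[s] (blockSet τ n₀ M) ≤ (M + 1 : ℝ≥0∞) ^ (τ n₀ + n₀) := by
  refine (Measure.hausdorffMeasure_le_liminf_tsum (ι := fun n => Fin (τ n + n) → ℕ) (l := atTop) s _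
    (fun n : ℕ => ENNReal.ofReal ((n : ℝ)⁻¹)) ?_ (fun n => blockCyl τ n₀ M (τ n + n)) ?_ ?_).trans ?_
  · rw [← ENNReal.ofReal_zero]
    exact ENNReal.tendsto_ofReal tendsto_inv_atTop_nhds_zero_nat
  · filter_upwards [eventually_ge_atTop 1] with n hn c
    rcases (blockCyl τ n₀ M (τ n + n) c).eq_empty_or_nonempty with h | ⟨x, hx⟩
    · simp [h]
    · refine (ediam_blockCyl_le hx).trans (ENNReal.ofReal_le_ofReal ?_)
      refine (prod_inv_sq_le_inv hx.1.1 (by omega)).trans ?_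
      have : (0 : ℝ) < n := by exact_mod_cast hn
      gcongr
      omega
  · refine Eventually.of_forall fun n x hx => mem_iUnion.2
      ⟨fun j => freeCode τ n₀ (fun j => pq x (j + 1)) j, hx, fun j => rfl⟩
  · refine liminf_le_of_frequently_le' (Eventually.frequently ?_)
    filter_upwards [eventually_ge_atTop n₀] with n hn
    refine le_trans ?_ (prod_tsum_codeWeight_le τ n₀ M n₀ e hK (τ n + n))
    rw [← tsum_prod_fin]
    refine ENNReal.tsum_le_tsum fun c => ?_
    rcases (blockCyl τ n₀ M (τ n + n) c).eq_empty_or_nonempty with h | ⟨x, hx⟩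
    · simp [h, hs]
    · have h1 : ∀ j, codeWeight τ n₀ M n₀ e j (freeCode τ n₀ (fun j => pq x (j + 1)) j) =
          ENNReal.ofReal (seqWeight τ n₀ e (fun j => pq x (j + 1)) j) :=
        codeWeight_freeCode hgap hn₀ hx.1.2.2 fun j hj => by
          have := succ_le_pq hx.1.1 j; omega
      calc Metric.ediam (blockCyl τ n₀ M (τ n + n) c) ^ s
          ≤ ENNReal.ofReal (∏ j ∈ Finset.range (τ n + n), ((pq x (j + 1) : ℝ) ^ 2)⁻¹) ^ s := by
            gcongr; exact ediam_blockCyl_le hx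
        _ = ENNReal.ofReal (∏ j ∈ Finset.range (τ n + n), (pq x (j + 1) : ℝ) ^ (-(2 * s))) := by
            rw [ENNReal.ofReal_rpow_of_nonneg (Finset.prod_nonneg fun _ _ => by positivity) hs.le,
              ← Real.finsetProd_rpow _ _ fun _ _ => by positivity]
            congr 1
            refine Finset.prod_congr rfl fun j _ => ?_
            rw [Real.rpow_neg (by positivity), Real.inv_rpow (by positivity),
              Real.rpow_mul (by positivity)]
            norm_num
        _ ≤ ENNReal.ofReal (∏ j ∈ Finset.range (τ n + n),
              seqWeight τ n₀ e (fun j => pq x (j + 1)) j) :=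
            ENNReal.ofReal_le_ofReal (prod_rpow_le_prod_seqWeight hgap hn₀ hs he hexp
              (pq_strictMono hx.1.1) (fun j => pq_pos ⟨hx.1.1.1, hx.1.1.2.1⟩ j) hn)
        _ = ∏ j ∈ Finset.range (τ n + n),
              ENNReal.ofReal (seqWeight τ n₀ e (fun j => pq x (j + 1)) j) :=
            ENNReal.ofReal_prod_of_nonneg fun j _ => seqWeight_nonneg _ _ _ _ _
        _ = ∏ j : Fin (τ n + n), codeWeight τ n₀ M n₀ e j (c j) := by
            rw [← Fin.prod_univ_eq_prod_range]
            exact Finset.prod_congr rfl fun j _ => by rw [← hx.2 j, h1]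

lemma one_le_of_gap {σ : ℕ → ℕ} (hσ1 : 1 ≤ σ 1) (hmono : ∀ n : ℕ, 1 ≤ n → σ n < σ (n + 1)) {n : ℕ}
    (hn : 1 ≤ n) : 1 ≤ σ n := by
  induction n, hn using Nat.le_induction with
  | base => exact hσ1
  | succ n hn ih => have := hmono n hn; omega

lemma shift_gap {σ : ℕ → ℕ} (hσ1 : 1 ≤ σ 1) (hmono : ∀ n : ℕ, 1 ≤ n → σ n < σ (n + 1))
    (hgap : ∀ n : ℕ, 1 ≤ n → n ≤ σ (n + 1) - σ n) (n : ℕ) (hn : 1 ≤ n) :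
    σ n - 1 + n ≤ σ (n + 1) - 1 := by
  have := one_le_of_gap hσ1 hmono hn
  have := hgap n hn
  have := hmono n hn
  omega

lemma eventually_exponent_le {σ : ℕ → ℕ} (hσ1 : 1 ≤ σ 1)
    (hmono : ∀ n : ℕ, 1 ≤ n → σ n < σ (n + 1))
    (hgap : ∀ n : ℕ, 1 ≤ n → n ≤ σ (n + 1) - σ n) {β : ℝ}
    (hlim : Filter.Tendsto (fun n : ℕ => ((σ (n + 1) - σ n : ℕ) : ℝ) / (n : ℝ))
      Filter.atTop (nhds β)) {s e : ℝ} (h : e * (β - 1) < 2 * s * β) :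
    ∀ᶠ k : ℕ in atTop, (e - 2 * s) * ((σ (k + 1) - 1 + 2 - (σ k - 1 + k) : ℕ) : ℝ) ≤
      2 * s * ((k - 1 : ℕ) : ℝ) := by
  have hi : Tendsto (fun n : ℕ => 1 / (n : ℝ)) atTop (𝓝 0) := tendsto_one_div_atTop_nhds_zero_nat
  have h1 : Tendsto (fun n : ℕ => (e - 2 * s) *
      (((σ (n + 1) - σ n : ℕ) : ℝ) / (n : ℝ) - 1 + 2 * (1 / (n : ℝ))) -
      2 * s * (1 - 1 / (n : ℝ))) atTop
      (𝓝 ((e - 2 * s) * (β - 1 + 2 * 0) - 2 * s * (1 - 0))) :=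
    (((hlim.sub_const 1).add (hi.const_mul 2)).const_mul _).sub ((hi.const_sub 1).const_mul _)
  have h2 : (e - 2 * s) * (β - 1 + 2 * 0) - 2 * s * (1 - 0) < 0 := by linarith
  filter_upwards [h1.eventually (gt_mem_nhds h2), eventually_ge_atTop 1] with k hk hk1
  have hk0 : (0 : ℝ) < k := by exact_mod_cast hk1
  have h3 := one_le_of_gap hσ1 hmono hk1
  have h4 := hgap k hk1
  have h5 := hmono k hk1
  have h6 : (σ (k + 1) - 1 + 2 - (σ k - 1 + k) : ℕ) = ((σ (k + 1) - σ k) + 2) - k := by omega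
  rw [h6, Nat.cast_sub (by omega), Nat.cast_sub hk1, Nat.cast_add]
  have h7 := mul_lt_mul_of_pos_left hk hk0
  have h8 : (k : ℝ) * ((e - 2 * s) *
      (((σ (k + 1) - σ k : ℕ) : ℝ) / (k : ℝ) - 1 + 2 * (1 / (k : ℝ))) -
      2 * s * (1 - 1 / (k : ℝ))) = (e - 2 * s) * (((σ (k + 1) - σ k : ℕ) : ℝ) + 2 - k) -
      2 * s * (k - 1) := by
    field_simp
    ring
  rw [h8] at h7
  push_cast
  linarith

lemma eventually_tsum_tail_le_one {e : ℝ} (he : 1 < e) :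
    ∀ᶠ K : ℕ in atTop,
      ∑' c : ℕ, (if K ≤ c then ENNReal.ofReal ((c : ℝ) ^ (-e)) else 0) ≤ 1 := by
  have hs : Summable fun c : ℕ => (c : ℝ) ^ (-e) := Real.summable_nat_rpow.2 (by linarith)
  have h1 := ENNReal.tendsto_sum_nat_add (fun c : ℕ => ENNReal.ofReal ((c : ℝ) ^ (-e)))
    hs.tsum_ofReal_ne_top
  filter_upwards [h1.eventually (gt_mem_nhds one_pos)] with K hK
  refine le_trans (le_of_eq ?_) hK.le
  rw [← Summable.sum_add_tsum_nat_add' (k := K) ENNReal.summable, Finset.sum_eq_zero fun c hc =>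
    if_neg (by rw [Finset.mem_range] at hc; omega), zero_add]
  exact tsum_congr fun c => if_pos (by omega)

lemma Gset_subset_iUnion {σ : ℕ → ℕ} (hσ1 : 1 ≤ σ 1)
    (hmono : ∀ n : ℕ, 1 ≤ n → σ n < σ (n + 1)) (N₀ : ℕ) :
    Gset σ ⊆ ⋃ p : ℕ × ℕ, blockSet (fun n => σ n - 1) (N₀ + p.1) p.2 := by
  rintro x ⟨hx, N, hN⟩
  refine mem_iUnion.2 ⟨(N, pq x (σ (N₀ + N) - 1 + (N₀ + N) + 1)), hx, fun n hn i hi => ?_,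
    fun j hj => (pq_strictMono hx).monotone hj.le⟩
  obtain ⟨d, hd⟩ := hN n (by omega)
  have h1 := hd i (by omega)
  have h2 := hd (i + 1) (by omega)
  have h3 := one_le_of_gap hσ1 hmono (by omega : 1 ≤ n)
  rw [show σ n + i + 1 = σ n - 1 + i + 1 + 1 by omega,
    show σ n + i = σ n - 1 + i + 1 by omega] at h1
  rw [show σ n + (i + 1) + 1 = σ n - 1 + i + 2 + 1 by omega,
    show σ n + (i + 1) = σ n - 1 + i + 1 + 1 by omega] at h2
  dsimp only
  omega

lemma dimH_Gset_le_of_lt {σ : ℕ → ℕ} (hσ1 : 1 ≤ σ 1)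
    (hmono : ∀ n : ℕ, 1 ≤ n → σ n < σ (n + 1))
    (hgap : ∀ n : ℕ, 1 ≤ n → n ≤ σ (n + 1) - σ n) {β : ℝ} (hβ : 1 ≤ β)
    (hlim : Filter.Tendsto (fun n : ℕ => ((σ (n + 1) - σ n : ℕ) : ℝ) / (n : ℝ))
      Filter.atTop (nhds β)) {s : ℝ} (hs : (β - 1) / (2 * β) < s) (hs2 : s < 1 / 2) :
    dimH (Gset σ) ≤ ENNReal.ofReal s := by
  have hs0 : 0 < s := lt_of_le_of_lt (div_nonneg (by linarith) (by linarith)) hs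
  rw [div_lt_iff₀ (by linarith)] at hs
  set δ : ℝ := (2 * s * β - (β - 1)) / (2 * β) with hδ
  have hδ0 : 0 < δ := div_pos (by linarith) (by linarith)
  have hδβ : δ * (2 * β) = 2 * s * β - (β - 1) := div_mul_cancel₀ _ (by linarith)
  obtain ⟨N₁, hN₁⟩ := eventually_atTop.1
    (eventually_exponent_le hσ1 hmono hgap hlim (s := s) (e := 1 + δ) (by nlinarith))
  obtain ⟨N₂, hN₂⟩ := eventually_atTop.1 (eventually_tsum_tail_le_one (e := 1 + δ) (by linarith))
  refine (dimH_mono (Gset_subset_iUnion hσ1 hmono (N₁ + N₂ + 1))).trans ?_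
  rw [dimH_iUnion]
  refine iSup_le fun p => dimH_le_of_hausdorffMeasure_ne_top (d := s.toNNReal) ?_
  rw [Real.coe_toNNReal s hs0.le]
  refine ne_top_of_le_ne_top ?_ (hausdorffMeasure_blockSet_le (shift_gap hσ1 hmono hgap)
    (by omega) hs0 (e := 1 + δ) (by linarith) (fun k hk => hN₁ k (by omega))
    (hN₂ _ (by omega)) p.2)
  exact ENNReal.pow_ne_top (by simp)

lemma dimH_Gset_le {σ : ℕ → ℕ} (hσ1 : 1 ≤ σ 1)
    (hmono : ∀ n : ℕ, 1 ≤ n → σ n < σ (n + 1))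
    (hgap : ∀ n : ℕ, 1 ≤ n → n ≤ σ (n + 1) - σ n) {β : ℝ} (hβ : 1 ≤ β)
    (hlim : Filter.Tendsto (fun n : ℕ => ((σ (n + 1) - σ n : ℕ) : ℝ) / (n : ℝ))
      Filter.atTop (nhds β)) :
    dimH (Gset σ) ≤ ENNReal.ofReal ((β - 1) / (2 * β)) := by
  have h : (β - 1) / (2 * β) < 1 / 2 := by
    rw [div_lt_div_iff₀ (by linarith) (by norm_num)]; linarith
  refine ge_of_tendsto (x := 𝓝[>] ((β - 1) / (2 * β)))
    (ENNReal.continuous_ofReal.continuousAt.mono_left nhdsWithin_le_nhds) ?_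
  filter_upwards [Ioo_mem_nhdsGT h] with s hs
  exact dimH_Gset_le_of_lt hσ1 hmono hgap hβ hlim hs.1 hs.2

/-- Position `j` lies in one of the blocks `[τ n, τ n + n)`. -/
def InBlock (τ : ℕ → ℕ) (j : ℕ) : Prop := ∃ n, 1 ≤ n ∧ τ n ≤ j ∧ j < τ n + n

lemma block_unique {τ : ℕ → ℕ} (hgap : ∀ n, 1 ≤ n → τ n + n ≤ τ (n + 1)) {m n j : ℕ}
    (hm : 1 ≤ m) (hn : 1 ≤ n) (h1 : τ m ≤ j) (h2 : j < τ m + m) (h3 : τ n ≤ j)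
    (h4 : j < τ n + n) : m = n := by
  rcases lt_trichotomy m n with h | h | h
  · have := le_of_gap hgap (by omega : 1 ≤ m + 1) h
    have := hgap m hm
    omega
  · exact h
  · have := le_of_gap hgap (by omega : 1 ≤ n + 1) h
    have := hgap n hn
    omega

open Classical in
/-- The number of binary digits consumed before position `i`. -/
noncomputable def digitCount (τ : ℕ → ℕ) (i : ℕ) : ℕ :=
  ∑ j ∈ Finset.range i, if InBlock τ j then 0 else j

open Classical in
/-- Partial quotients encoding the binary expansion of `t` in the positions outside the blocks. -/
noncomputable def encode (τ : ℕ → ℕ) (t : ℝ) (j : ℕ) : ℕ :=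
  if h : InBlock τ j then 2 ^ (τ h.choose + 1) * (1 + (j - τ h.choose))
  else 2 ^ (j + 1) + ⌊t * 2 ^ digitCount τ (j + 1)⌋₊ % 2 ^ j

lemma encode_of_mem_block {τ : ℕ → ℕ} (hgap : ∀ n, 1 ≤ n → τ n + n ≤ τ (n + 1)) (t : ℝ) {n j : ℕ}
    (hn : 1 ≤ n) (h1 : τ n ≤ j) (h2 : j < τ n + n) :
    encode τ t j = 2 ^ (τ n + 1) * (1 + (j - τ n)) := by
  have h : InBlock τ j := ⟨n, hn, h1, h2⟩
  obtain ⟨h3, h4, h5⟩ := h.choose_spec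
  rw [encode, dif_pos h, block_unique hgap h3 hn h4 h5 h1 h2]

lemma encode_of_not_inBlock {τ : ℕ → ℕ} (t : ℝ) {j : ℕ} (h : ¬ InBlock τ j) :
    encode τ t j = 2 ^ (j + 1) + ⌊t * 2 ^ digitCount τ (j + 1)⌋₊ % 2 ^ j := by
  rw [encode, dif_neg h]

lemma encode_lt {τ : ℕ → ℕ} (hgap : ∀ n, 1 ≤ n → τ n + n ≤ τ (n + 1)) (t : ℝ) (j : ℕ) :
    encode τ t j < 2 ^ (j + 2) := by
  by_cases h : InBlock τ j
  · obtain ⟨n, hn, h1, h2⟩ := h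
    rw [encode_of_mem_block hgap t hn h1 h2]
    have h3 : j - τ n < 2 ^ (j - τ n) := Nat.lt_two_pow_self
    calc 2 ^ (τ n + 1) * (1 + (j - τ n)) ≤ 2 ^ (τ n + 1) * 2 ^ (j - τ n) :=
          Nat.mul_le_mul_left _ (by omega)
      _ = 2 ^ (j + 1) := by rw [← pow_add]; congr 1; omega
      _ < 2 ^ (j + 2) := Nat.pow_lt_pow_right (by norm_num) (by omega)
  · rw [encode_of_not_inBlock t h]
    have h3 : ⌊t * 2 ^ digitCount τ (j + 1)⌋₊ % 2 ^ j < 2 ^ j := Nat.mod_lt _ (by positivity)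
    have h4 : 2 ^ (j + 2) = 4 * 2 ^ j := by ring
    have h5 : 2 ^ (j + 1) = 2 * 2 ^ j := by ring
    omega

lemma two_le_encode {τ : ℕ → ℕ} (hgap : ∀ n, 1 ≤ n → τ n + n ≤ τ (n + 1)) (t : ℝ) (j : ℕ) :
    2 ≤ encode τ t j := by
  have h0 : ∀ m : ℕ, 2 ≤ 2 ^ (m + 1) := fun m => by
    have : 1 ≤ 2 ^ m := Nat.one_le_two_pow
    rw [pow_succ]; omega
  by_cases h : InBlock τ j
  · obtain ⟨n, hn, h1, h2⟩ := h
    rw [encode_of_mem_block hgap t hn h1 h2]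
    exact (h0 _).trans (Nat.le_mul_of_pos_right _ (by omega))
  · rw [encode_of_not_inBlock t h]
    exact (h0 _).trans (Nat.le_add_right _ _)

lemma encode_lt_succ {τ : ℕ → ℕ} (hgap : ∀ n, 1 ≤ n → τ n + n ≤ τ (n + 1)) (t : ℝ) (j : ℕ) :
    encode τ t j < encode τ t (j + 1) := by
  by_cases h : InBlock τ (j + 1)
  · obtain ⟨n, hn, h1, h2⟩ := h
    rw [encode_of_mem_block hgap t hn h1 h2]
    rcases Nat.lt_or_ge j (τ n) with h3 | h3
    · refine (encode_lt hgap t j).trans_le ?_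
      rw [show τ n = j + 1 by omega]
      simp
    · rw [encode_of_mem_block hgap t hn h3 (by omega)]
      exact Nat.mul_lt_mul_of_pos_left (by omega) (by positivity)
  · rw [encode_of_not_inBlock t h]
    exact (encode_lt hgap t j).trans_le (Nat.le_add_right _ _)

lemma digitCount_succ_of_not_inBlock {τ : ℕ → ℕ} {j : ℕ} (h : ¬ InBlock τ j) :
    digitCount τ (j + 1) = digitCount τ j + j := by
  rw [digitCount, Finset.sum_range_succ, if_neg h, digitCount]

lemma digitCount_succ_of_inBlock {τ : ℕ → ℕ} {j : ℕ} (h : InBlock τ j) :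
    digitCount τ (j + 1) = digitCount τ j := by
  rw [digitCount, Finset.sum_range_succ, if_pos h, digitCount, add_zero]

lemma digitCount_mono (τ : ℕ → ℕ) : Monotone (digitCount τ) :=
  fun _ _ h => Finset.sum_le_sum_of_subset (Finset.range_mono h)

lemma abs_sub_lt_of_floor_eq {u v : ℝ} (hu : 0 ≤ u) (hv : 0 ≤ v) (h : ⌊u⌋₊ = ⌊v⌋₊) :
    |u - v| < 1 := by
  have h1 := Nat.floor_le hu
  have h2 := Nat.lt_floor_add_one u
  have h3 := Nat.floor_le hv
  have h4 := Nat.lt_floor_add_one v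
  rw [h] at h1 h2
  rw [abs_lt]
  constructor <;> linarith

/-- Distinct numbers are close to the precision of the first position at which their codes
differ. -/
lemma exists_first_difference {τ : ℕ → ℕ} (hS : ∀ m, ∃ i, m ≤ digitCount τ i) {t u : ℝ}
    (ht : t ∈ Ico (0 : ℝ) 1) (hu : u ∈ Ico (0 : ℝ) 1) (hne : t ≠ u) :
    ∃ j, (∀ l < j, encode τ t l = encode τ u l) ∧ encode τ t j ≠ encode τ u j ∧
      |t - u| * 2 ^ digitCount τ j ≤ 1 := by
  have hpos : ∀ i, (0 : ℝ) < 2 ^ digitCount τ i := fun i => by positivity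
  have hclose : ∀ i, ⌊t * 2 ^ digitCount τ i⌋₊ = ⌊u * 2 ^ digitCount τ i⌋₊ →
      |t - u| * 2 ^ digitCount τ i < 1 := fun i h => by
    have := abs_sub_lt_of_floor_eq (mul_nonneg ht.1 (hpos i).le) (mul_nonneg hu.1 (hpos i).le) h
    rwa [← sub_mul, abs_mul, abs_of_pos (hpos i)] at this
  have hex : ∃ i, ⌊t * 2 ^ digitCount τ i⌋₊ ≠ ⌊u * 2 ^ digitCount τ i⌋₊ := by
    by_contra! hall
    have h0 : 0 < |t - u| := abs_pos.2 (sub_ne_zero.2 hne)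
    obtain ⟨m, hm⟩ := pow_unbounded_of_one_lt (1 / |t - u|) (one_lt_two : (1 : ℝ) < 2)
    obtain ⟨i, hi⟩ := hS m
    have h1 := hclose i (hall i)
    rw [div_lt_iff₀ h0] at hm
    have h2 : (2 : ℝ) ^ m ≤ 2 ^ digitCount τ i := pow_le_pow_right₀ (by norm_num) hi
    nlinarith
  classical
  obtain ⟨i, hi, hmin⟩ : ∃ i, ⌊t * 2 ^ digitCount τ i⌋₊ ≠ ⌊u * 2 ^ digitCount τ i⌋₊ ∧
      ∀ l < i, ⌊t * 2 ^ digitCount τ l⌋₊ = ⌊u * 2 ^ digitCount τ l⌋₊ :=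
    ⟨Nat.find hex, Nat.find_spec hex, fun l hl => not_not.1 (Nat.find_min hex hl)⟩
  obtain ⟨j, rfl⟩ : ∃ j, i = j + 1 := by
    refine ⟨i - 1, ?_⟩
    rcases Nat.eq_zero_or_pos i with rfl | h
    · exfalso
      apply hi
      simp only [digitCount, Finset.range_zero, Finset.sum_empty, pow_zero, mul_one]
      rw [Nat.floor_eq_zero.2 ht.2, Nat.floor_eq_zero.2 hu.2]
    · omega
  have hj := hmin j (by omega)
  have hnb : ¬ InBlock τ j := fun hb => by
    rw [digitCount_succ_of_inBlock hb] at hi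
    exact hi hj
  refine ⟨j, fun l hl => ?_, fun h => ?_, (hclose j hj).le⟩
  · by_cases hb : InBlock τ l
    · simp only [encode, dif_pos hb]
    · rw [encode_of_not_inBlock t hb, encode_of_not_inBlock u hb, hmin (l + 1) (by omega)]
  · rw [encode_of_not_inBlock t hnb, encode_of_not_inBlock u hnb] at h
    have hdiv : ∀ z : ℝ, ⌊z * 2 ^ digitCount τ (j + 1)⌋₊ / 2 ^ j = ⌊z * 2 ^ digitCount τ j⌋₊ :=
      fun z => by
        rw [← Nat.floor_div_natCast, digitCount_succ_of_not_inBlock hnb, pow_add]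
        congr 1
        push_cast
        field_simp
    apply hi
    rw [← Nat.div_add_mod ⌊t * 2 ^ digitCount τ (j + 1)⌋₊ (2 ^ j),
      ← Nat.div_add_mod ⌊u * 2 ^ digitCount τ (j + 1)⌋₊ (2 ^ j), hdiv, hdiv, hj]
    omega

lemma prod_inv_two_pow (j : ℕ) :
    ∏ l ∈ Finset.range j, (((2 : ℝ) ^ (l + 2)) ^ 2)⁻¹ = (2 ^ (j * (j + 3)))⁻¹ := by
  induction j with
  | zero => simp
  | succ j ih =>
    rw [Finset.prod_range_succ, ih, ← mul_inv, ← pow_mul, ← pow_add]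
    congr 2
    ring

lemma inv_two_pow_le_abs_sub {x y : ℝ} (hx : x ∈ Ioo (0 : ℝ) 1 ∧ Irrational x)
    (hy : y ∈ Ioo (0 : ℝ) 1 ∧ Irrational y) (hxb : ∀ l, pq x (l + 1) < 2 ^ (l + 2))
    (hyb : ∀ l, pq y (l + 1) < 2 ^ (l + 2)) {j : ℕ}
    (h : ∀ l < j, pq x (l + 1) = pq y (l + 1)) (hne : pq x (j + 1) ≠ pq y (j + 1)) :
    ((2 : ℝ) ^ ((j + 3) ^ 2))⁻¹ ≤ |x - y| := by
  wlog hlt : pq x (j + 1) < pq y (j + 1) generalizing x y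
  · rw [abs_sub_comm]
    exact this hy hx hyb hxb (fun l hl => (h l hl).symm) hne.symm (by omega)
  refine le_trans ?_ (prod_le_abs_sub_of_pq_lt hx hy j h hlt)
  have hxb' : ∀ l, (pq x (l + 1) : ℝ) + 1 ≤ 2 ^ (l + 2) := fun l => by
    exact_mod_cast hxb l
  have hyb' : ∀ l, (pq y (l + 1) : ℝ) + 1 ≤ 2 ^ (l + 2) := fun l => by
    exact_mod_cast hyb l
  calc ((2 : ℝ) ^ ((j + 3) ^ 2))⁻¹ ≤ (2 ^ (j * (j + 3) + (j + 2) + (j + 2) + (j + 3)))⁻¹ := by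
        refine inv_anti₀ (by positivity) (pow_le_pow_right₀ (by norm_num) ?_)
        nlinarith
    _ = (2 ^ (j * (j + 3)))⁻¹ * (1 / 2 ^ (j + 2) * (1 / 2 ^ (j + 2)) * (1 / 2 ^ (j + 1 + 2))) := by
        simp only [one_div, ← mul_inv, ← pow_add]
        congr 2
        ring
    _ ≤ _ := by
        rw [← prod_inv_two_pow]
        gcongr
        · exact hxb' _
        · exact hxb' j
        · exact hyb' j
        · exact hyb' (j + 1)

lemma ofReal_le_dimH_of_antiholder {E : Set ℝ} {g : ℝ → ℝ} {s C : ℝ} (hs : 0 < s)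
    (hC : 0 ≤ C) (hg : ∀ t ∈ Ico (0 : ℝ) 1, g t ∈ E)
    (h : ∀ t ∈ Ico (0 : ℝ) 1, ∀ u ∈ Ico (0 : ℝ) 1, |t - u| ≤ C * |g t - g u| ^ s) :
    ENNReal.ofReal s ≤ dimH E := by
  have hinj : InjOn g (Ico (0 : ℝ) 1) := fun t ht u hu htu => by
    have h1 := h t ht u hu
    rw [htu, sub_self, abs_zero, Real.zero_rpow hs.ne', mul_zero] at h1
    exact sub_eq_zero.1 (abs_nonpos_iff.1 h1)
  have hleft := hinj.leftInvOn_invFunOn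
  have hhol : HolderOnWith C.toNNReal s.toNNReal (Function.invFunOn g (Ico (0 : ℝ) 1))
      (g '' Ico (0 : ℝ) 1) := by
    rintro _ ⟨t, ht, rfl⟩ _ ⟨u, hu, rfl⟩
    rw [hleft ht, hleft hu, edist_dist, edist_dist, Real.dist_eq, Real.dist_eq,
      Real.coe_toNNReal s hs.le, ENNReal.ofReal_rpow_of_nonneg (abs_nonneg _) hs.le]
    change _ ≤ ENNReal.ofReal C * _
    rw [← ENNReal.ofReal_mul hC]
    exact ENNReal.ofReal_le_ofReal (h t ht u hu)
  have h1 := hhol.dimH_image_le (Real.toNNReal_pos.2 hs)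
  rw [hleft.image_image] at h1
  have h2 : dimH (Ico (0 : ℝ) 1) = 1 := by
    rw [Real.dimH_of_nonempty_interior (by rw [interior_Ico]; exact ⟨1 / 2, by norm_num⟩)]
    simp
  rw [h2, ENNReal.le_div_iff_mul_le (Or.inl (by simpa using hs)) (Or.inl ENNReal.coe_ne_top),
    one_mul] at h1
  exact h1.trans (dimH_mono (image_subset_iff.2 hg))

lemma ofReal_le_dimH_Gset {σ : ℕ → ℕ} (hσ1 : 1 ≤ σ 1)
    (hmono : ∀ n : ℕ, 1 ≤ n → σ n < σ (n + 1))
    (hgap : ∀ n : ℕ, 1 ≤ n → n ≤ σ (n + 1) - σ n) {s D : ℝ} (hs : 0 < s)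
    (hD : ∀ i : ℕ, s * ((i : ℝ) + 3) ^ 2 ≤ digitCount (fun n => σ n - 1) i + D) :
    ENNReal.ofReal s ≤ dimH (Gset σ) := by
  have hgap' := shift_gap hσ1 hmono hgap
  set τ : ℕ → ℕ := fun n => σ n - 1 with hτ
  choose g hg hgpq using fun t => exists_pq_eq (two_le_encode (τ := τ) hgap' t)
  refine ofReal_le_dimH_of_antiholder (g := g) (C := 2 ^ D) hs (by positivity)
    (fun t _ => ?_) fun t ht u hu => ?_
  · refine ⟨⟨(hg t).1, (hg t).2, fun n hn => ?_⟩, 1, fun n hn => ?_⟩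
    · obtain ⟨j, rfl⟩ : ∃ j, n = j + 1 := ⟨n - 1, by omega⟩
      rw [hgpq, hgpq]
      exact encode_lt_succ hgap' t j
    · refine ⟨2 ^ (τ n + 1), fun i hi => ?_⟩
      have h1 := one_le_of_gap hσ1 hmono hn
      have h2 : σ n = τ n + 1 := by simp only [hτ]; omega
      rw [show σ n + i + 1 = τ n + i + 1 + 1 by omega, show σ n + i = τ n + i + 1 by omega,
        hgpq, hgpq, encode_of_mem_block hgap' t hn (by omega) (by omega),
        encode_of_mem_block hgap' t hn (by omega) (by omega),
        show τ n + i + 1 - τ n = i + 1 by omega, show τ n + i - τ n = i by omega]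
      push_cast
      ring
  · rcases eq_or_ne t u with rfl | hne
    · simp [Real.zero_rpow hs.ne']
    · have hS : ∀ m, ∃ i, m ≤ digitCount τ i := fun m => by
        obtain ⟨i, hi⟩ := exists_nat_gt ((m + D) / s)
        refine ⟨i, ?_⟩
        rw [div_lt_iff₀ hs] at hi
        have h1 := hD i
        have h2 : (i : ℝ) ≤ ((i : ℝ) + 3) ^ 2 := by nlinarith [Nat.cast_nonneg (α := ℝ) i]
        have h3 : (m : ℝ) ≤ digitCount τ i := by nlinarith
        exact_mod_cast h3
      obtain ⟨j, h1, h2, h3⟩ := exists_first_difference hS ht hu hne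
      have h4 := inv_two_pow_le_abs_sub (hg t) (hg u)
        (fun l => by rw [hgpq]; exact encode_lt hgap' t l)
        (fun l => by rw [hgpq]; exact encode_lt hgap' u l)
        (fun l hl => by rw [hgpq, hgpq]; exact h1 l hl) (by rw [hgpq, hgpq]; exact h2)
      calc |t - u| ≤ ((2 : ℝ) ^ digitCount τ j)⁻¹ := by
            rw [← one_div, le_div_iff₀ (by positivity)]; exact h3
        _ = (2 : ℝ) ^ (-(digitCount τ j : ℝ)) := by
            rw [Real.rpow_neg (by norm_num), Real.rpow_natCast]
        _ ≤ (2 : ℝ) ^ (D + -((j : ℝ) + 3) ^ 2 * s) :=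
            Real.rpow_le_rpow_of_exponent_le (by norm_num) (by linarith [hD j])
        _ = 2 ^ D * (((2 : ℝ) ^ ((j + 3) ^ 2))⁻¹) ^ s := by
            rw [show -((j : ℝ) + 3) ^ 2 = -(((j + 3) ^ 2 : ℕ) : ℝ) by push_cast; ring,
              Real.rpow_add (by norm_num), Real.rpow_mul (by norm_num),
              Real.rpow_neg (by norm_num), Real.rpow_natCast]
        _ ≤ 2 ^ D * |g t - g u| ^ s := by gcongr

lemma not_inBlock_of_gap {τ : ℕ → ℕ} (hgap : ∀ n, 1 ≤ n → τ n + n ≤ τ (n + 1)) {k j : ℕ}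
    (h1 : τ k + k ≤ j) (h2 : j < τ (k + 1)) : ¬ InBlock τ j := by
  rintro ⟨n, hn, h3, h4⟩
  rcases le_or_gt n k with h | h
  · have := le_of_gap hgap hn h; omega
  · have := le_of_gap hgap (by omega : 1 ≤ k + 1) h; omega

lemma digitCount_block_le {τ : ℕ → ℕ} (hgap : ∀ n, 1 ≤ n → τ n + n ≤ τ (n + 1)) {k : ℕ}
    (hk : 1 ≤ k) :
    digitCount τ (τ k) + (τ (k + 1) - (τ k + k)) * τ k ≤ digitCount τ (τ (k + 1)) := by
  have hg := hgap k hk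
  refine (Nat.add_le_add_right (digitCount_mono τ (by omega : τ k ≤ τ k + k)) _).trans ?_
  unfold digitCount
  rw [← Finset.sum_range_add_sum_Ico _ hg]
  refine Nat.add_le_add_left ?_ _
  rw [← Nat.card_Ico, ← smul_eq_mul]
  refine Finset.card_nsmul_le_sum _ _ _ fun j hj => ?_
  rw [Finset.mem_Ico] at hj
  rw [if_neg (not_inBlock_of_gap hgap hj.1 hj.2)]
  omega

lemma mul_pred_le_of_gap {τ : ℕ → ℕ} (hgap : ∀ n, 1 ≤ n → τ n + n ≤ τ (n + 1)) {n : ℕ}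
    (hn : 1 ≤ n) : (n : ℝ) * (n - 1) / 2 ≤ τ n := by
  induction n, hn using Nat.le_induction with
  | base => simp
  | succ n hn ih =>
    have h1 : (τ n : ℝ) + n ≤ τ (n + 1) := by exact_mod_cast hgap n hn
    push_cast
    linarith

lemma exists_block_index {τ : ℕ → ℕ} (hlt : ∀ n, 1 ≤ n → τ n < τ (n + 1)) {m : ℕ} (hm : 1 ≤ m)
    {i : ℕ} (hi : τ m ≤ i) : ∃ n, m ≤ n ∧ τ n ≤ i ∧ i < τ (n + 1) := by
  induction i, hi using Nat.le_induction with
  | base => exact ⟨m, le_rfl, le_rfl, hlt m hm⟩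
  | succ i hi ih =>
    obtain ⟨n, h1, h2, h3⟩ := ih
    rcases Nat.lt_or_ge (i + 1) (τ (n + 1)) with h | h
    · exact ⟨n, h1, by omega, h⟩
    · exact ⟨n + 1, by omega, h, by have := hlt (n + 1) (by omega); omega⟩

lemma tendsto_div_of_gap {τ : ℕ → ℕ} (hgap : ∀ n, 1 ≤ n → τ n + n ≤ τ (n + 1)) :
    Tendsto (fun n : ℕ => (n : ℝ) / τ n) atTop (𝓝 0) := by
  have h1 : Tendsto (fun n : ℕ => 2 / ((n : ℝ) - 1)) atTop (𝓝 0) :=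
    Tendsto.div_atTop tendsto_const_nhds
      (tendsto_atTop_add_const_right _ (-1) tendsto_natCast_atTop_atTop)
  refine squeeze_zero' (Eventually.of_forall fun n => by positivity) ?_ h1
  filter_upwards [eventually_ge_atTop 2] with n hn
  have h2 : (2 : ℝ) ≤ n := by exact_mod_cast hn
  have h3 := mul_pred_le_of_gap hgap (by omega : 1 ≤ n)
  have h4 : (0 : ℝ) < τ n := lt_of_lt_of_le (by nlinarith) h3
  rw [div_le_div_iff₀ h4 (by linarith)]
  linarith

lemma eventually_growth {τ : ℕ → ℕ} (hgap : ∀ n, 1 ≤ n → τ n + n ≤ τ (n + 1)) {β : ℝ}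
    (hlim : Tendsto (fun n : ℕ => ((τ (n + 1) : ℝ) - τ n) / n) atTop (𝓝 β)) {s : ℝ}
    (hs : 2 * s * β < β - 1) :
    ∀ᶠ n : ℕ in atTop, s * ((τ (n + 1 + 1) : ℝ) + 3) ^ 2 - s * ((τ (n + 1) : ℝ) + 3) ^ 2 ≤
      ((τ (n + 1) : ℝ) - (τ n + n)) * τ n := by
  have hi : Tendsto (fun n : ℕ => 1 / (n : ℝ)) atTop (𝓝 0) := tendsto_one_div_atTop_nhds_zero_nat
  have hτ := tendsto_div_of_gap hgap
  have hnext : Tendsto (fun n : ℕ => ((τ (n + 1 + 1) : ℝ) - τ (n + 1)) / (n + 1 : ℕ) *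
      (1 + 1 / (n : ℝ))) atTop (𝓝 (β * (1 + 0))) :=
    (hlim.comp (tendsto_add_atTop_nat 1)).mul (hi.const_add 1)
  have hall := ((hnext.const_mul s).mul (((((hlim.const_mul 2).mul hτ).const_add 2).add
    ((hi.const_mul 6).mul hτ)).add (hnext.mul hτ))).sub (hlim.sub_const 1)
  have hneg : s * (β * (1 + 0)) * (2 + 2 * β * 0 + 6 * 0 * 0 + β * (1 + 0) * 0) - (β - 1) < 0 := by
    linarith
  filter_upwards [hall.eventually (gt_mem_nhds hneg), eventually_ge_atTop 2] with n hn hn2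
  have h2 : (2 : ℝ) ≤ n := by exact_mod_cast hn2
  have h3 := mul_pred_le_of_gap hgap (by omega : 1 ≤ n)
  have h4 : (0 : ℝ) < τ n := lt_of_lt_of_le (by nlinarith) h3
  have h5 := mul_lt_mul_of_pos_left hn (mul_pos (by linarith : (0 : ℝ) < n) h4)
  rw [mul_zero] at h5
  have h6 : s * ((τ (n + 1 + 1) : ℝ) + 3) ^ 2 - s * ((τ (n + 1) : ℝ) + 3) ^ 2 -
      ((τ (n + 1) : ℝ) - (τ n + n)) * τ n < 0 := by
    refine lt_of_eq_of_lt ?_ h5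
    push_cast
    field_simp
    ring
  linarith

lemma exists_le_digitCount_add {τ : ℕ → ℕ} (hgap : ∀ n, 1 ≤ n → τ n + n ≤ τ (n + 1)) {β : ℝ}
    (hlim : Tendsto (fun n : ℕ => ((τ (n + 1) : ℝ) - τ n) / n) atTop (𝓝 β)) {s : ℝ} (hs0 : 0 < s)
    (hs : 2 * s * β < β - 1) :
    ∃ D : ℝ, ∀ i : ℕ, s * ((i : ℝ) + 3) ^ 2 ≤ digitCount τ i + D := by
  obtain ⟨m, hm⟩ := eventually_atTop.1
    ((eventually_growth hgap hlim hs).and (eventually_ge_atTop 1))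
  have hm1 : 1 ≤ m := (hm m le_rfl).2
  have hlt : ∀ n, 1 ≤ n → τ n < τ (n + 1) := fun n hn => by have := hgap n hn; omega
  have key : ∀ n, m ≤ n → s * ((τ (n + 1) : ℝ) + 3) ^ 2 ≤
      digitCount τ (τ n) + s * ((τ (m + 1) : ℝ) + 3) ^ 2 := fun n hn => by
    induction n, hn using Nat.le_induction with
    | base => simp
    | succ n hn ih =>
      have h1 := (hm n hn).1
      have hn1 : 1 ≤ n := by omega
      have h2 : ((digitCount τ (τ n) + (τ (n + 1) - (τ n + n)) * τ n : ℕ) : ℝ) ≤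
          digitCount τ (τ (n + 1)) := by exact_mod_cast digitCount_block_le hgap hn1
      rw [Nat.cast_add, Nat.cast_mul, Nat.cast_sub (hgap n hn1), Nat.cast_add] at h2
      linarith
  refine ⟨s * ((τ (m + 1) : ℝ) + 3) ^ 2, fun i => ?_⟩
  rcases Nat.lt_or_ge i (τ m) with h | h
  · have h1 : (i : ℝ) ≤ τ (m + 1) := by
      have := hlt m hm1
      exact_mod_cast (by omega : i ≤ τ (m + 1))
    have h2 : s * ((i : ℝ) + 3) ^ 2 ≤ s * ((τ (m + 1) : ℝ) + 3) ^ 2 := by gcongr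
    have h3 : (0 : ℝ) ≤ digitCount τ i := Nat.cast_nonneg _
    linarith
  · obtain ⟨n, hn, h1, h2⟩ := exists_block_index hlt hm1 h
    have h3 : (i : ℝ) ≤ τ (n + 1) := by exact_mod_cast h2.le
    have h4 : s * ((i : ℝ) + 3) ^ 2 ≤ s * ((τ (n + 1) : ℝ) + 3) ^ 2 := by gcongr
    have h5 : (digitCount τ (τ n) : ℝ) ≤ digitCount τ i := by
      exact_mod_cast digitCount_mono τ h1
    linarith [key n hn]

lemma le_dimH_Gset {σ : ℕ → ℕ} (hσ1 : 1 ≤ σ 1)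
    (hmono : ∀ n : ℕ, 1 ≤ n → σ n < σ (n + 1))
    (hgap : ∀ n : ℕ, 1 ≤ n → n ≤ σ (n + 1) - σ n) {β : ℝ} (hβ : 1 ≤ β)
    (hlim : Filter.Tendsto (fun n : ℕ => ((σ (n + 1) - σ n : ℕ) : ℝ) / (n : ℝ))
      Filter.atTop (nhds β)) :
    ENNReal.ofReal ((β - 1) / (2 * β)) ≤ dimH (Gset σ) := by
  rcases hβ.eq_or_lt with rfl | hβ
  · simp
  have hlim' : Tendsto (fun n : ℕ => (((σ (n + 1) - 1 : ℕ) : ℝ) - ((σ n - 1 : ℕ) : ℝ)) / n)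
      atTop (𝓝 β) := by
    refine hlim.congr' ?_
    filter_upwards [eventually_ge_atTop 1] with n hn
    have h1 := one_le_of_gap hσ1 hmono hn
    have h2 := hmono n hn
    rw [← Nat.cast_sub (by omega), show σ (n + 1) - 1 - (σ n - 1) = σ (n + 1) - σ n by omega]
  have h : 0 < (β - 1) / (2 * β) := div_pos (by linarith) (by linarith)
  refine le_of_tendsto (x := 𝓝[<] ((β - 1) / (2 * β)))
    (ENNReal.continuous_ofReal.continuousAt.mono_left nhdsWithin_le_nhds) ?_
  filter_upwards [Ioo_mem_nhdsLT h] with s hs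
  have hs2 := (lt_div_iff₀ (by linarith)).1 hs.2
  obtain ⟨D, hD⟩ := exists_le_digitCount_add (τ := fun n => σ n - 1)
    (shift_gap hσ1 hmono hgap) hlim' hs.1 (by linarith)
  exact ofReal_le_dimH_Gset hσ1 hmono hgap hs.1 hD

/-- Theorem 1.2 (case `β < ∞`): the Hausdorff dimension of the `G`-set equals
`(β-1)/(2β)` where `β = lim (σ_{n+1} - σ_n)/n`. -/
theorem stmt2 (σ : ℕ → ℕ) (hσ1 : 1 ≤ σ 1)
    (hmono : ∀ n : ℕ, 1 ≤ n → σ n < σ (n + 1))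
    (hgap : ∀ n : ℕ, 1 ≤ n → n ≤ σ (n + 1) - σ n)
    (β : ℝ) (hβ : 1 ≤ β)
    (hlim : Filter.Tendsto (fun n : ℕ => ((σ (n + 1) - σ n : ℕ) : ℝ) / (n : ℝ))
      Filter.atTop (nhds β)) :
    dimH (Gset σ) = ENNReal.ofReal ((β - 1) / (2 * β)) := by
  exact le_antisymm (dimH_Gset_le hσ1 hmono hgap hβ hlim) (le_dimH_Gset hσ1 hmono hgap hβ hlim)
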